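/- The centralizer C := {α ∈ Aff_3(k) : α ∘ φ = φ ∘ α} equals {β_u : u ∈ k^*, u^7 = 1}. Consequently, C is a cyclic group of order seven if k contains a primitive seventh root of unity, and C = {id_{k[x1,x2,x3]}} otherwise. -/

import Mathlib

open MvPolynomial

noncomputable section

namespace YasudaPaper

variable {k : Type*} [Field k]

/-- `f := x1*x3 - x2^2` (variables: `X 0 = x1, X 1 = x2, X 2 = x3`). -/
def fP : MvPolynomial (Fin 3) k := X 0 * X 2 - X 1 ^ 2

/-- `r := x2*f + x1^2`. -/
def rP : MvPolynomial (Fin 3) k := X 1 * fP + X 0 ^ 2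

/-- `g := x3*f^2 + 2*x1*x2*f + x1^3`. -/
def gP : MvPolynomial (Fin 3) k := X 2 * fP ^ 2 + 2 * X 0 * X 1 * fP + X 0 ^ 3

/-- The Jacobian derivation `Δ = Δ_{(f,g)}`, `h ↦ det ∂(f,g,h)/∂(x1,x2,x3)`. -/
def Del (h : MvPolynomial (Fin 3) k) : MvPolynomial (Fin 3) k :=
  Matrix.det !![pderiv 0 fP, pderiv 1 fP, pderiv 2 fP;
                pderiv 0 gP, pderiv 1 gP, pderiv 2 gP;
                pderiv 0 h,  pderiv 1 h,  pderiv 2 h]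

/-- `φ = exp D`: for every `h` and every `N` with `D^[N] h = 0`,
    `φ h = ∑_{i<N} D^i(h)/i!`.  (For a locally nilpotent `D` this characterizes
    the exponential automorphism.) -/
def IsExpOf {σ : Type*} (D : MvPolynomial σ k → MvPolynomial σ k)
    (φ : MvPolynomial σ k ≃ₐ[k] MvPolynomial σ k) : Prop :=
  ∀ (h : MvPolynomial σ k) (N : ℕ), D^[N] h = 0 →
    φ h = ∑ i ∈ Finset.range N, (Nat.factorial i : k)⁻¹ • D^[i] h

/-- `α` is an affine automorphism: `α(x_i) = ∑_j a_{j,i} x_j + b_i` with `A ∈ GL₃(k)`. -/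
def IsAffine (α : MvPolynomial (Fin 3) k ≃ₐ[k] MvPolynomial (Fin 3) k) : Prop :=
  ∃ (A : Matrix (Fin 3) (Fin 3) k) (b : Fin 3 → k), IsUnit A.det ∧
    ∀ i : Fin 3, α (X i) = (∑ j : Fin 3, C (A j i) * X j) + C (b i)

/-- `Aff_3(k)` as a set of automorphisms. -/
def AffSet : Set (MvPolynomial (Fin 3) k ≃ₐ[k] MvPolynomial (Fin 3) k) := {α | IsAffine α}

/-- `α` is a triangular automorphism: `α(x_i) = a_i x_i + f_i(x_1,…,x_{i-1})`, `a_i ≠ 0`. -/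
def IsTriangular (α : MvPolynomial (Fin 3) k ≃ₐ[k] MvPolynomial (Fin 3) k) : Prop :=
  ∃ (a : Fin 3 → k) (p : Fin 3 → MvPolynomial (Fin 3) k),
    (∀ i, a i ≠ 0) ∧ (∀ i, p i ∈ MvPolynomial.supported k {j | j < i}) ∧
    (∀ i, α (X i) = C (a i) * X i + p i)

/-- `BA_3(k)` as a set of automorphisms. -/
def TriSet : Set (MvPolynomial (Fin 3) k ≃ₐ[k] MvPolynomial (Fin 3) k) := {α | IsTriangular α}

/-- The tame subgroup `TA_3(k) = ⟨Aff_3(k), BA_3(k)⟩`. -/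
def TA : Subgroup (MvPolynomial (Fin 3) k ≃ₐ[k] MvPolynomial (Fin 3) k) :=
  Subgroup.closure (AffSet ∪ TriSet)

/-- `β = β_u = (u^3 x1, u^2 x2, u x3)`. -/
def IsBeta (u : k) (β : MvPolynomial (Fin 3) k ≃ₐ[k] MvPolynomial (Fin 3) k) : Prop :=
  β (X 0) = C (u ^ 3) * X 0 ∧ β (X 1) = C (u ^ 2) * X 1 ∧ β (X 2) = C u * X 2

/-- `B = {β_u | u ∈ k^*}`. -/
def BSet : Set (MvPolynomial (Fin 3) k ≃ₐ[k] MvPolynomial (Fin 3) k) :=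
  {β | ∃ u : k, u ≠ 0 ∧ IsBeta u β}

/-! Six-variable ring `k[x1,x2,x3,t_r,t_f,t_g]`:
variables `X 0 = x1, X 1 = x2, X 2 = x3, X 3 = t_r, X 4 = t_f, X 5 = t_g`. -/

/-- The inclusion of variable index sets. -/
def ι36 : Fin 3 → Fin 6 := Fin.castLE (by norm_num)

/-- The embedding `k[x1,x2,x3] → k[x1,x2,x3,t_r,t_f,t_g]`. -/
def embP : MvPolynomial (Fin 3) k →ₐ[k] MvPolynomial (Fin 6) k := rename ι36

/-- The substitution map `π : t_r ↦ r, t_f ↦ f, t_g ↦ g` (fixing `x1,x2,x3`). -/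
def piMap : MvPolynomial (Fin 6) k →ₐ[k] MvPolynomial (Fin 3) k :=
  aeval ![X 0, X 1, X 2, rP, fP, gP]

/-- The triangular derivation
`Δ' = -2 t_r t_f ∂/∂x1 + (4 x1 t_r - t_g) ∂/∂x2 + (6 x2 t_r + 2 t_f²) ∂/∂x3 - t_f t_g ∂/∂t_r`. -/
def Del' (p : MvPolynomial (Fin 6) k) : MvPolynomial (Fin 6) k :=
  (-(2 * X 3 * X 4)) * pderiv 0 p + (4 * X 0 * X 3 - X 5) * pderiv 1 p +
  (6 * X 1 * X 3 + 2 * X 4 ^ 2) * pderiv 2 p + (-(X 4 * X 5)) * pderiv 3 p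

/-- The weight `w1 = (1,2,3,1,0,1)`. -/
def w1 : Fin 6 → ℕ := ![1, 2, 3, 1, 0, 1]

/-- The weight `w2 = (0,0,0,0,1,0)`. -/
def w2 : Fin 6 → ℕ := ![0, 0, 0, 0, 1, 0]

/-- The sixth cyclic lexicographic order on exponent vectors: first compare the
exponent of `t_g`, then lexicographically the exponents of `x1,x2,x3,t_r,t_f`. -/
def cyclicLt (a b : Fin 6 →₀ ℕ) : Prop :=
  a 5 < b 5 ∨ (a 5 = b 5 ∧ ∃ m : Fin 5,
    (∀ l : Fin 5, l < m → a l.castSucc = b l.castSucc) ∧ a m.castSucc < b m.castSucc)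

/-- The leading monomial of `p` (for the sixth cyclic lexicographic order) is `m`. -/
def LeadMonIs (p : MvPolynomial (Fin 6) k) (m : Fin 6 →₀ ℕ) : Prop :=
  m ∈ p.support ∧ ∀ m' ∈ p.support, m' ≠ m → cyclicLt m' m

/-- The exponent vector of the monomial `t_f^δ t_g^γ`. -/
def tfMon (γ δ : ℕ) : Fin 6 →₀ ℕ := Finsupp.single 4 δ + Finsupp.single 5 γ

/-- The set `P_{γ,δ}`. -/
def Pset (γ δ : ℕ) : Set (MvPolynomial (Fin 6) k) :=
  {p | p ≠ 0 ∧ weightedTotalDegree w1 p ≤ γ ∧ weightedTotalDegree w2 p ≤ δ ∧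
    LeadMonIs p (tfMon γ δ)}

/-- `α'` is a lift of `α`. -/
def IsLift (α : MvPolynomial (Fin 3) k ≃ₐ[k] MvPolynomial (Fin 3) k)
    (α' : MvPolynomial (Fin 6) k →ₐ[k] MvPolynomial (Fin 6) k) : Prop :=
  (∀ i : Fin 3, α' (X (ι36 i)) = embP (α (X i))) ∧
  (∀ p, piMap (α' p) = α (piMap p))

/-- `t = γ_j = max {i | a_{i,j} ≠ 0}` (with rows indexed `1,2,3`). -/
def TypeIs (A : Matrix (Fin 3) (Fin 3) k) (j : Fin 3) (t : ℕ) : Prop :=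
  ∃ i : Fin 3, t = (i : ℕ) + 1 ∧ A i j ≠ 0 ∧ ∀ i' : Fin 3, i < i' → A i' j = 0

/-- Condition (C) for a lift `α'` of an affine automorphism of type `(γ1,γ2,γ3)`,
relative to `φ' = exp(uΔ')`. -/
def CondC (γ1 γ2 γ3 : ℕ) (φ' : MvPolynomial (Fin 6) k ≃ₐ[k] MvPolynomial (Fin 6) k)
    (α' : MvPolynomial (Fin 6) k →ₐ[k] MvPolynomial (Fin 6) k) : Prop :=
  ∃ m4 m5 m6 n4 n5 n6 : ℕ,
    1 ≤ n4 ∧ 1 ≤ n5 ∧ 1 ≤ n6 ∧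
    φ' (α' (X 3)) ∈ Pset m4 n4 ∧
    φ' (α' (X 4)) ∈ Pset m5 n5 ∧
    φ' (α' (X 5)) ∈ Pset m6 n6 ∧
    γ1 ≤ m6 ∧ γ2 ≤ 2 * m6 ∧ γ3 ≤ 3 * m6 ∧ m4 ≤ m6 ∧
    γ1 + 1 ≤ n6 - 1 ∧ γ2 + 1 ≤ 2 * (n6 - 1) ∧ γ3 + 1 ≤ 3 * (n6 - 1) ∧ n4 ≤ n6 - 1

/-- The image of `x_j` under the affine map given by `(A, d)`, inside the six-variable ring. -/
def affImg (A : Matrix (Fin 3) (Fin 3) k) (d : Fin 3 → k) (j : Fin 3) :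
    MvPolynomial (Fin 6) k :=
  (∑ i : Fin 3, C (A i j) * X (ι36 i)) + C (d j)

/-- The image of `t_f` under the lift `α̂`:
`α̂(t_f) = α(f) + (a_{1,1}a_{3,3} - 2a_{1,2}a_{3,2} + a_{1,3}a_{3,1})(t_f - f)`. -/
def hatTf (A : Matrix (Fin 3) (Fin 3) k) (d : Fin 3 → k) : MvPolynomial (Fin 6) k :=
  (affImg A d 0 * affImg A d 2 - affImg A d 1 ^ 2) +
    C (A 0 0 * A 2 2 - 2 * (A 0 1 * A 2 1) + A 0 2 * A 2 0) *
      (X 4 - (X 0 * X 2 - X 1 ^ 2))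

/-- The lift `α̂` of the affine automorphism given by `(A, d)`:
`α̂(x_i) = α(x_i)`, `α̂(t_f)` as in `hatTf`, `α̂(t_r) = α̂(x2 t_f + x1²)`,
`α̂(t_g) = α̂(x3 t_f² + 2 x1 x2 t_f + x1³)`. -/
def hatLift (A : Matrix (Fin 3) (Fin 3) k) (d : Fin 3 → k) :
    MvPolynomial (Fin 6) k →ₐ[k] MvPolynomial (Fin 6) k :=
  aeval ![affImg A d 0, affImg A d 1, affImg A d 2,
    affImg A d 1 * hatTf A d + affImg A d 0 ^ 2,
    hatTf A d,
    affImg A d 2 * hatTf A d ^ 2 + 2 * affImg A d 0 * affImg A d 1 * hatTf A d +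
      affImg A d 0 ^ 3]

/-- The value of `Δ x_i`. -/
def delX : Fin 3 → MvPolynomial (Fin 3) k :=
  ![-(2 * rP * fP), 4 * X 0 * rP - gP, 6 * X 1 * rP + 2 * fP ^ 2]

lemma pderiv_two (i : Fin 3) : pderiv i (2 : MvPolynomial (Fin 3) k) = 0 :=
  (pderiv i).map_natCast 2

lemma Del_eq (h : MvPolynomial (Fin 3) k) :
    Del h = delX 0 * pderiv 0 h + delX 1 * pderiv 1 h + delX 2 * pderiv 2 h := by
  simp [Del, Matrix.det_fin_three, delX, fP, gP, rP, Derivation.leibniz, Derivation.leibniz_pow,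
    pderiv_X, pderiv_two]
  ring

lemma Del_add (p q : MvPolynomial (Fin 3) k) : Del (p + q) = Del p + Del q := by
  simp only [Del_eq, map_add]; ring

lemma Del_smul (c : k) (p : MvPolynomial (Fin 3) k) : Del (c • p) = c • Del p := by
  simp only [Del_eq, Derivation.map_smul]; simp only [smul_eq_C_mul]; ring

lemma Del_mul (p q : MvPolynomial (Fin 3) k) : Del (p * q) = p * Del q + q * Del p := by
  simp only [Del_eq, Derivation.leibniz, smul_eq_mul]; ring

lemma Del_C (c : k) : Del (C c : MvPolynomial (Fin 3) k) = 0 := by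
  simp [Del_eq]

lemma Del_X (i : Fin 3) : Del (X i : MvPolynomial (Fin 3) k) = delX i := by
  fin_cases i <;> simp [Del_eq, pderiv_X]

lemma Del_fP : Del (fP : MvPolynomial (Fin 3) k) = 0 := by
  simp [Del_eq, delX, fP, gP, rP, Derivation.leibniz, Derivation.leibniz_pow, pderiv_X]
  ring

/-- `Δ` as a linear endomorphism. -/
def delLin : Module.End k (MvPolynomial (Fin 3) k) where
  toFun := Del
  map_add' := Del_add
  map_smul' := Del_smul

/-- A polynomial `T = 1 + X + ⋯` has an inverse under composition modulo `X ^ n`. -/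
lemma exists_comp_eq_X_add (S : Polynomial k) (n : ℕ) :
    ∃ P Q : Polynomial k,
      P.comp (1 + Polynomial.X * (1 + Polynomial.X * S)) =
        Polynomial.X + Polynomial.X ^ n * Q := by
  induction n with
  | zero => exact ⟨0, -Polynomial.X, by simp⟩
  | succ n ih =>
    obtain ⟨P, Q, h⟩ := ih
    obtain ⟨R, hR⟩ : ∃ R, (1 + Polynomial.X * S) ^ n = 1 + Polynomial.X * R := by
      obtain ⟨R, hR⟩ := sub_dvd_pow_sub_pow (1 + Polynomial.X * S) 1 n
      exact ⟨S * R, by linear_combination hR⟩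
    refine ⟨P - Polynomial.C (Q.coeff 0) * (Polynomial.X - 1) ^ n,
      Q.divX - Polynomial.C (Q.coeff 0) * R, ?_⟩
    have hQ := Q.divX_mul_X_add
    simp only [Polynomial.sub_comp, Polynomial.mul_comp, Polynomial.C_comp, Polynomial.pow_comp,
      Polynomial.X_comp, Polynomial.one_comp, add_sub_cancel_left, mul_pow, h, hR]
    linear_combination -Polynomial.X ^ n * hQ

/-- Truncations of the exponential series invert modulo `X ^ (n + 2)`. -/
lemma exists_comp_exp_trunc (n : ℕ) :
    ∃ P Q : Polynomial k,
      P.comp (∑ i ∈ Finset.range (n + 2), (Nat.factorial i : k)⁻¹ • Polynomial.X ^ i) =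
        Polynomial.X + Polynomial.X ^ (n + 2) * Q := by
  obtain ⟨P, Q, h⟩ := exists_comp_eq_X_add
    (∑ i ∈ Finset.range n, (Nat.factorial (i + 2) : k)⁻¹ • Polynomial.X ^ i : Polynomial k) (n + 2)
  refine ⟨P, Q, ?_⟩
  rw [← h]
  congr 1
  rw [Finset.sum_range_succ', Finset.sum_range_succ']
  simp only [mul_add, Finset.mul_sum, mul_smul_comm]
  simp [pow_succ', add_comm, add_left_comm]

section Exp

variable {φ : MvPolynomial (Fin 3) k ≃ₐ[k] MvPolynomial (Fin 3) k}

lemma delLin_pow_apply (n : ℕ) (h : MvPolynomial (Fin 3) k) : (delLin ^ n) h = Del^[n] h :=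
  Module.End.pow_apply _ _ _

lemma Del_iterate_eq_zero {h : MvPolynomial (Fin 3) k} {n m : ℕ} (hnm : n ≤ m)
    (hn : Del^[n] h = 0) : Del^[m] h = 0 := by
  rw [← delLin_pow_apply, ← Nat.sub_add_cancel hnm, pow_add, Module.End.mul_apply,
    delLin_pow_apply n, hn, map_zero]

/-- On the kernel of `Δ ^ N`, polynomials in `φ = exp Δ` are polynomials in `Δ`. -/
lemma aeval_exp_apply (hφ : IsExpOf Del φ) (P : Polynomial k) {N : ℕ}
    {h : MvPolynomial (Fin 3) k} (hN : Del^[N] h = 0) :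
    Polynomial.aeval φ.toLinearMap P h =
      Polynomial.aeval delLin
        (P.comp (∑ i ∈ Finset.range N, (Nat.factorial i : k)⁻¹ • Polynomial.X ^ i)) h := by
  set T : Polynomial k := ∑ i ∈ Finset.range N, (Nat.factorial i : k)⁻¹ • Polynomial.X ^ i
  have hT : ∀ h : MvPolynomial (Fin 3) k, Del^[N] h = 0 → φ h = Polynomial.aeval delLin T h := by
    intro h hN
    rw [hφ h N hN]
    simp [T, LinearMap.sum_apply, delLin_pow_apply]
  have hker : ∀ (Q : Polynomial k) (h : MvPolynomial (Fin 3) k), Del^[N] h = 0 →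
      Del^[N] (Polynomial.aeval delLin Q h) = 0 := by
    intro Q h hN
    have : Commute (delLin (k := k) ^ N) (Polynomial.aeval delLin Q) := by
      rw [← Polynomial.aeval_X_pow (R := k) (x := delLin (k := k))]
      exact (Commute.all _ _).map (Polynomial.aeval delLin)
    rw [← delLin_pow_apply, ← Module.End.mul_apply, this.eq, Module.End.mul_apply,
      delLin_pow_apply, hN, map_zero]
  induction P using Polynomial.induction_on' with
  | add p q hp hq => simp [hp, hq]
  | monomial n a =>
    simp only [← Polynomial.C_mul_X_pow_eq_monomial, Polynomial.mul_comp, Polynomial.C_comp,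
      Polynomial.pow_comp, Polynomial.X_comp, map_mul, Polynomial.aeval_C, map_pow,
      Polynomial.aeval_X, Module.End.mul_apply]
    congr 1
    induction n with
    | zero => simp
    | succ n ih =>
      rw [pow_succ', pow_succ', Module.End.mul_apply, Module.End.mul_apply, ih,
        AlgEquiv.toLinearMap_apply, hT]
      rw [← map_pow]
      exact hker _ _ hN

/-- An endomorphism commuting with `exp Δ` commutes with `Δ`. -/
lemma Del_comm_of_exp_comm (hln : ∀ h : MvPolynomial (Fin 3) k, ∃ l : ℕ, Del^[l] h = 0)
    (hφ : IsExpOf Del φ) {α : MvPolynomial (Fin 3) k ≃ₐ[k] MvPolynomial (Fin 3) k}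
    (hα : α * φ = φ * α) (h : MvPolynomial (Fin 3) k) : α (Del h) = Del (α h) := by
  obtain ⟨l, hl⟩ := hln h
  obtain ⟨m, hm⟩ := hln (α h)
  obtain ⟨P, Q, hPQ⟩ := exists_comp_exp_trunc (k := k) (l + m)
  have key : ∀ p : MvPolynomial (Fin 3) k, Del^[l + m + 2] p = 0 →
      Polynomial.aeval φ.toLinearMap P p = Del p := by
    intro p hp
    rw [aeval_exp_apply hφ P hp, hPQ, mul_comm]
    simp only [map_add, map_mul, map_pow, Polynomial.aeval_X, LinearMap.add_apply,
      Module.End.mul_apply, delLin_pow_apply, hp, map_zero, add_zero]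
    rfl
  have hcomm : Commute α.toLinearMap φ.toLinearMap := LinearMap.ext fun p => by
    simpa using DFunLike.congr_fun hα p
  have hP : Commute α.toLinearMap (Polynomial.aeval φ.toLinearMap P) := by
    rw [Polynomial.aeval_eq_sum_range]
    exact Commute.sum_right _ _ _ fun i _ => (hcomm.pow_right i).smul_right _
  rw [← key h (Del_iterate_eq_zero (by omega) hl), ← key (α h) (Del_iterate_eq_zero (by omega) hm)]
  exact DFunLike.congr_fun hP.eq h

/-- An automorphism commuting with `Δ` commutes with `exp Δ`. -/
lemma exp_comm_of_Del_comm (hln : ∀ h : MvPolynomial (Fin 3) k, ∃ l : ℕ, Del^[l] h = 0)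
    (hφ : IsExpOf Del φ) {α : MvPolynomial (Fin 3) k ≃ₐ[k] MvPolynomial (Fin 3) k}
    (hα : ∀ h, α (Del h) = Del (α h)) : α * φ = φ * α := by
  ext1 h
  obtain ⟨N, hN⟩ := hln h
  have hit : ∀ i, Del^[i] (α h) = α (Del^[i] h) := fun i =>
    ((Function.Semiconj.iterate_right (f := α) hα i) h).symm
  rw [AlgEquiv.mul_apply, AlgEquiv.mul_apply, hφ h N hN, hφ (α h) N (by rw [hit, hN, map_zero])]
  simp [hit, map_sum]

end Exp

section Beta

variable {u v : k} {a b : MvPolynomial (Fin 3) k ≃ₐ[k] MvPolynomial (Fin 3) k}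

lemma algEquiv_ext (h : ∀ i, a (X i) = b (X i)) : a = b := by
  have : a.toAlgHom = b.toAlgHom := MvPolynomial.algHom_ext h
  ext1 p
  exact DFunLike.congr_fun this p

lemma IsBeta.eq (ha : IsBeta u a) (hb : IsBeta u b) : a = b := by
  refine algEquiv_ext fun i => ?_
  obtain ⟨h0, h1, h2⟩ := ha
  obtain ⟨g0, g1, g2⟩ := hb
  fin_cases i <;> simp_all

lemma isBeta_one : IsBeta (1 : k) 1 := by simp [IsBeta]

lemma IsBeta.mul (ha : IsBeta u a) (hb : IsBeta v b) : IsBeta (u * v) (a * b) := by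
  obtain ⟨h0, h1, h2⟩ := ha
  obtain ⟨g0, g1, g2⟩ := hb
  have hC : ∀ c : k, a (C c) = C c := fun c => a.commutes c
  refine ⟨?_, ?_, ?_⟩ <;>
    simp only [AlgEquiv.mul_apply, g0, g1, g2, map_mul, h0, h1, h2, hC, mul_pow] <;> ring

lemma IsBeta.pow (ha : IsBeta u a) (n : ℕ) : IsBeta (u ^ n) (a ^ n) := by
  induction n with
  | zero => simpa using isBeta_one
  | succ n ih => simpa [pow_succ] using ih.mul ha

lemma IsBeta.ne_one (ha : IsBeta u a) (hu : u ≠ 1) : a ≠ 1 := by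
  rintro rfl
  have := congrArg (eval fun _ => (1 : k)) ha.2.2
  simp at this
  exact hu this.symm

lemma exists_isBeta (hu : u ≠ 0) :
    ∃ β : MvPolynomial (Fin 3) k ≃ₐ[k] MvPolynomial (Fin 3) k, IsBeta u β := by
  let B : k → MvPolynomial (Fin 3) k →ₐ[k] MvPolynomial (Fin 3) k := fun u =>
    aeval ![C (u ^ 3) * X 0, C (u ^ 2) * X 1, C u * X 2]
  have hB : ∀ u v : k, u * v = 1 → (B u).comp (B v) = AlgHom.id k _ := by
    intro u v huv
    have h (n : ℕ) : (C v ^ n * C u ^ n : MvPolynomial (Fin 3) k) = 1 := by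
      rw [← mul_pow, ← C_mul, mul_comm v, huv, C_1, one_pow]
    refine MvPolynomial.algHom_ext fun i => ?_
    fin_cases i
    · simp [B, algebraMap_eq, ← mul_assoc, h]
    · simp [B, algebraMap_eq, ← mul_assoc, h]
    · simpa [B, algebraMap_eq, ← mul_assoc] using congrArg (· * X 2) (h 1)
  exact ⟨AlgEquiv.ofAlgHom (B u) (B u⁻¹) (hB _ _ (mul_inv_cancel₀ hu))
    (hB _ _ (inv_mul_cancel₀ hu)), by simp [IsBeta, B]⟩

lemma IsBeta.isAffine (hu : u ≠ 0) (ha : IsBeta u a) : IsAffine a := by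
  obtain ⟨h0, h1, h2⟩ := ha
  refine ⟨Matrix.diagonal ![u ^ 3, u ^ 2, u], 0, ?_, fun i => ?_⟩
  · simp [Matrix.det_diagonal, Fin.prod_univ_three, hu]
  · fin_cases i <;> simp [Fin.sum_univ_three, Matrix.diagonal, h0, h1, h2]

lemma IsBeta.Del_comm (hu : u ^ 7 = 1) (ha : IsBeta u a) (h : MvPolynomial (Fin 3) k) :
    a (Del h) = Del (a h) := by
  have hC : ∀ c : k, a (C c) = C c := fun c => a.commutes c
  have hX : ∀ i, a (delX i) = Del (a (X i)) := by
    obtain ⟨h0, h1, h2⟩ := ha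
    have hu' : (C u : MvPolynomial (Fin 3) k) ^ 7 = 1 := by rw [← C_pow, hu, C_1]
    have a2 : a 2 = 2 := map_ofNat a 2
    have a4 : a 4 = 4 := map_ofNat a 4
    have a6 : a 6 = 6 := map_ofNat a 6
    intro i
    fin_cases i
    · simp only [Fin.zero_eta, h0, Del_mul, Del_C, Del_X]
      simp [delX, rP, fP, gP, h0, h1, h2, a2]
      grind
    · simp only [Fin.mk_one, h1, Del_mul, Del_C, Del_X]
      simp [delX, rP, fP, gP, h0, h1, h2, a2, a4]
      grind
    · simp only [Fin.reduceFinMk, h2, Del_mul, Del_C, Del_X]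
      simp [delX, rP, fP, h0, h1, h2, a2, a6]
      grind
  induction h using MvPolynomial.induction_on with
  | C c => simp [Del_C, hC]
  | add p q hp hq => simp [Del_add, hp, hq]
  | mul_X p i hp => rw [Del_mul, map_mul, Del_mul, Del_X, map_add, map_mul, map_mul, hp, hX]

end Beta

/-- The quadratic polynomials killed by `Δ` are the affine combinations of `f`. -/
lemma quadratic_of_Del_eq_zero [CharZero k] {b0 b1 b2 b3 c11 c12 c13 c22 c23 c33 : k}
    {q : MvPolynomial (Fin 3) k}
    (hq : q = C b0 + C b1 * X 0 + C b2 * X 1 + C b3 * X 2 + C c11 * X 0 ^ 2 + C c12 * (X 0 * X 1)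
      + C c13 * (X 0 * X 2) + C c22 * X 1 ^ 2 + C c23 * (X 1 * X 2) + C c33 * X 2 ^ 2)
    (h : Del q = 0) : q = C c13 * fP + C b0 := by
  have key : ∀ x y z : k, eval ![x, y, z] (Del q) = 0 := by simp [h]
  simp [hq, Del_eq, delX, rP, fP, gP, Derivation.leibniz, Derivation.leibniz_pow, pderiv_X] at key
  have e1 := key 0 1 0
  have e2 := key 0 1 1
  have e3 := key 0 1 (-1)
  have e4 := key 0 (-1) 0
  have e5 := key 0 (-1) 1
  have e6 := key 0 2 0
  have e7 := key 1 1 1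
  have e8 := key 1 (-1) 1
  have e9 := key 1 0 1
  have e10 := key 1 0 0
  ring_nf at e1 e2 e3 e4 e5 e6 e7 e8 e9 e10
  have h12 : c12 = 0 := by grind
  have h3 : b3 = 0 := by grind
  have h23 : c23 = 0 := by grind
  have h1 : b1 = 0 := by grind
  have h13 : c22 = -c13 := by grind
  have h2 : b2 = 0 := by grind
  have h33 : c33 = 0 := by grind
  have h11 : c11 = 0 := by grind
  subst h12 h3 h23 h1 h13 h2 h33 h11
  rw [hq]
  simp [fP]
  ring

lemma coeff_eq_zero_of_forall [CharZero k] {a0 a1 a2 a3 a4 a5 : k}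
    (h : ∀ t : k, a0 + a1 * t + a2 * t ^ 2 + a3 * t ^ 3 + a4 * t ^ 4 + a5 * t ^ 5 = 0) :
    a3 = 0 ∧ a4 = 0 ∧ a5 = 0 := by
  have e0 := h 0
  have e1 := h 1
  have e2 := h (-1)
  have e3 := h 2
  have e4 := h (-2)
  have e5 := h 3
  refine ⟨?_, ?_, ?_⟩ <;> grind

/-- An affine automorphism commuting with `Δ` is diagonal of the form `β_u` with `u ^ 7 = 1`. -/
lemma exists_isBeta_of_Del_comm [CharZero k]
    {α : MvPolynomial (Fin 3) k ≃ₐ[k] MvPolynomial (Fin 3) k}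
    (haff : IsAffine α) (hα : ∀ h, α (Del h) = Del (α h)) :
    ∃ u : k, u ≠ 0 ∧ u ^ 7 = 1 ∧ IsBeta u α := by
  obtain ⟨A, b, hdet, hA⟩ := haff
  have hdet : A.det ≠ 0 := hdet.ne_zero
  rw [Matrix.det_fin_three] at hdet
  simp only [Fin.sum_univ_three] at hA
  have a2 : α 2 = 2 := map_ofNat α 2
  have a6 : α 6 = 6 := map_ofNat α 6
  obtain ⟨c, d, hf⟩ : ∃ c d : k, α fP = C c * fP + C d := by
    refine ⟨_, _, quadratic_of_Del_eq_zero (q := α fP)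
      (b0 := b 0 * b 2 - b 1 ^ 2)
      (b1 := A 0 0 * b 2 + A 0 2 * b 0 - 2 * A 0 1 * b 1)
      (b2 := A 1 0 * b 2 + A 1 2 * b 0 - 2 * A 1 1 * b 1)
      (b3 := A 2 0 * b 2 + A 2 2 * b 0 - 2 * A 2 1 * b 1)
      (c11 := A 0 0 * A 0 2 - A 0 1 ^ 2)
      (c12 := A 0 0 * A 1 2 + A 1 0 * A 0 2 - 2 * A 0 1 * A 1 1)
      (c13 := A 0 0 * A 2 2 + A 2 0 * A 0 2 - 2 * A 0 1 * A 2 1)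
      (c22 := A 1 0 * A 1 2 - A 1 1 ^ 2)
      (c23 := A 1 0 * A 2 2 + A 2 0 * A 1 2 - 2 * A 1 1 * A 2 1)
      (c33 := A 2 0 * A 2 2 - A 2 1 ^ 2) ?_ ?_⟩
    · simp only [fP, map_sub, map_mul, map_pow, hA, map_add, map_ofNat]
      ring
    · rw [← hα, Del_fP, map_zero]
  have hfx : ∀ x y z : k,
      (A 0 0 * x + A 1 0 * y + A 2 0 * z + b 0) * (A 0 2 * x + A 1 2 * y + A 2 2 * z + b 2)
        - (A 0 1 * x + A 1 1 * y + A 2 1 * z + b 1) ^ 2 = c * (x * z - y ^ 2) + d := by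
    intro x y z
    simpa [fP, hA] using congrArg (eval ![x, y, z]) hf
  have hD : ∀ x y z : k,
      6 * (A 0 1 * x + A 1 1 * y + A 2 1 * z + b 1) *
        ((A 0 1 * x + A 1 1 * y + A 2 1 * z + b 1) * (c * (x * z - y ^ 2) + d)
          + (A 0 0 * x + A 1 0 * y + A 2 0 * z + b 0) ^ 2) + 2 * (c * (x * z - y ^ 2) + d) ^ 2
      = A 0 2 * -(2 * (y * (x * z - y ^ 2) + x ^ 2) * (x * z - y ^ 2))
        + A 1 2 * (4 * x * (y * (x * z - y ^ 2) + x ^ 2) -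
          (z * (x * z - y ^ 2) ^ 2 + 2 * x * y * (x * z - y ^ 2) + x ^ 3))
        + A 2 2 * (6 * y * (y * (x * z - y ^ 2) + x ^ 2) + 2 * (x * z - y ^ 2) ^ 2) := by
    intro x y z
    have h := hα (X 2)
    rw [hA 2] at h
    simp only [Del_add, Del_mul, Del_C, Del_X, mul_zero, add_zero] at h
    simp only [delX, Matrix.cons_val, map_add, map_mul, map_pow, a2, a6, rP, hf, hA, gP] at h
    simpa [fP] using congrArg (eval ![x, y, z]) h
  clear hf hα a2 a6
  have hA0 := hA 0
  have hA1 := hA 1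
  have hA2 := hA 2
  clear hA
  generalize A 0 0 = a00 at *
  generalize A 0 1 = a01 at *
  generalize A 0 2 = a02 at *
  generalize A 1 0 = a10 at *
  generalize A 1 1 = a11 at *
  generalize A 1 2 = a12 at *
  generalize A 2 0 = a20 at *
  generalize A 2 1 = a21 at *
  generalize A 2 2 = a22 at *
  have hline (x y z : k) := coeff_eq_zero_of_forall
    (a0 := 6 * (b 1 ^ 2 * d + b 0 ^ 2 * b 1) + 2 * d ^ 2)
    (a1 := 12 * (a01 * x + a11 * y + a21 * z) * b 1 * d
      + 12 * (a00 * x + a10 * y + a20 * z) * b 0 * b 1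
      + 6 * b 0 ^ 2 * (a01 * x + a11 * y + a21 * z))
    (a2 := 6 * ((a01 * x + a11 * y + a21 * z) ^ 2 * d + b 1 ^ 2 * c * (x * z - y ^ 2)
      + (a00 * x + a10 * y + a20 * z) ^ 2 * b 1
      + 2 * (a00 * x + a10 * y + a20 * z) * b 0 * (a01 * x + a11 * y + a21 * z))
      + 4 * c * d * (x * z - y ^ 2))
    (a3 := 12 * (a01 * x + a11 * y + a21 * z) * b 1 * c * (x * z - y ^ 2)
      + 6 * (a00 * x + a10 * y + a20 * z) ^ 2 * (a01 * x + a11 * y + a21 * z)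
      - 3 * a12 * x ^ 3 - 6 * a22 * x ^ 2 * y)
    (a4 := 6 * (a01 * x + a11 * y + a21 * z) ^ 2 * c * (x * z - y ^ 2) + 2 * c ^ 2 * (x * z - y ^ 2) ^ 2
      + 2 * a02 * x ^ 2 * (x * z - y ^ 2) - 2 * a12 * x * y * (x * z - y ^ 2)
      - a22 * (6 * y ^ 2 * (x * z - y ^ 2) + 2 * (x * z - y ^ 2) ^ 2))
    (a5 := 2 * a02 * y * (x * z - y ^ 2) ^ 2 + a12 * z * (x * z - y ^ 2) ^ 2)
    (fun t => by linear_combination hD (t * x) (t * y) (t * z))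
  clear hD
  obtain rfl : a02 = 0 := by
    have h := (hline 0 1 0).2.2
    grind
  obtain rfl : a12 = 0 := by
    have h := (hline 0 1 1).2.2
    grind
  have hs : a22 ≠ 0 := by
    rintro rfl
    simp at hdet
  have h4 : c * a11 ^ 2 = a22 ∧ a01 = 0 ∧ a21 = 0 ∧ c ^ 2 = a22 := by
    have e0 := (hline 0 1 0).2.1
    have e1 := (hline 1 0 1).2.1
    have e2 := (hline 1 0 (-1)).2.1
    have e3 := (hline 1 0 2).2.1
    have e4 := (hline 1 0 (-2)).2.1
    ring_nf at e0 e1 e2 e3 e4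
    have hc : c ≠ 0 := by
      rintro rfl
      exact hs (by linear_combination e0 / 4)
    have h01 : a01 ^ 2 + a21 ^ 2 = 0 := by
      have : c * (a01 ^ 2 + a21 ^ 2) = 0 := by linear_combination (e1 - e2) / 12
      exact (mul_eq_zero.mp this).resolve_left hc
    have h02 : a01 ^ 2 + 4 * a21 ^ 2 = 0 := by
      have : c * (a01 ^ 2 + 4 * a21 ^ 2) = 0 := by linear_combination (e3 - e4) / 24
      exact (mul_eq_zero.mp this).resolve_left hc
    have h01' : a01 = 0 := by
      have : a01 ^ 2 = 0 := by linear_combination (4 * h01 - h02) / 3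
      exact pow_eq_zero_iff two_ne_zero |>.mp this
    have h21 : a21 = 0 := by
      have : a21 ^ 2 = 0 := by linear_combination (h02 - h01) / 3
      exact pow_eq_zero_iff two_ne_zero |>.mp this
    subst h01' h21
    have hc2 : c ^ 2 = a22 := by linear_combination e1 / 2
    exact ⟨by linear_combination -e0 / 6 + hc2 / 3, rfl, rfl, hc2⟩
  obtain ⟨hq, rfl, rfl, hc⟩ := h4
  have hc0 : c ≠ 0 := by grind
  have hb : a10 = 0 ∧ a20 = 0 ∧ b 0 = 0 ∧ b 1 = 0 ∧ b 2 = 0 ∧ a00 * a22 = c := by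
    have f0 := hfx 0 0 0
    have f1 := hfx 1 0 0
    have f2 := hfx 0 1 0
    have f3 := hfx 0 0 1
    have f4 := hfx 0 0 (-1)
    have f5 := hfx 1 0 1
    have f6 := hfx 0 1 1
    ring_nf at f0 f1 f2 f3 f4 f5 f6
    have h11 : a11 ≠ 0 := by
      rintro rfl
      exact hs (by linear_combination -hq)
    have hx : a00 * b 2 = 0 := by linear_combination f1 - f0
    have hxz : a00 * a22 = c := by linear_combination f5 - f3 - f1 + f0
    have h00 : a00 ≠ 0 := by
      rintro rfl
      exact hc0 (by linear_combination -hxz)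
    have hb2 : b 2 = 0 := (mul_eq_zero.mp hx).resolve_left h00
    have h10 : a10 = 0 := by
      have : a22 * a10 = 0 := by linear_combination f6 - f2 - f3 + f0
      exact (mul_eq_zero.mp this).resolve_left hs
    have h20 : a20 = 0 := by
      have : a22 * a20 = 0 := by linear_combination (f3 + f4) / 2 - f0
      exact (mul_eq_zero.mp this).resolve_left hs
    subst h10 h20
    have hb0 : b 0 = 0 := by
      have : a22 * b 0 = 0 := by linear_combination (f3 - f4) / 2
      exact (mul_eq_zero.mp this).resolve_left hs
    have hb1 : b 1 = 0 := by
      have f7 := hfx 0 (-1) 0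
      have : a11 * b 1 = 0 := by linear_combination (f7 - f2) / 4
      exact (mul_eq_zero.mp this).resolve_left h11
    exact ⟨rfl, rfl, hb0, hb1, hb2, hxz⟩
  obtain ⟨rfl, rfl, hb0, hb1, hb2, h0⟩ := hb
  have h3 : a00 ^ 2 * a11 = a22 := by
    have := (hline 1 1 0).1
    simp [hb1] at this
    grind
  have h11 : c = a11 ^ 2 := mul_left_cancel₀ hc0 (by linear_combination hc - hq)
  subst h11
  subst hc
  have hq0 : a11 ≠ 0 := by
    rintro rfl
    simp at hc0
  have h02 : a00 * a11 ^ 2 = 1 := mul_left_cancel₀ hc0 (by linear_combination h0)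
  have h7 : a11 ^ 7 = 1 := by
    linear_combination (-a11 ^ 3) * h3 + (a00 * a11 ^ 2 + 1) * h02
  refine ⟨(a11 ^ 2) ^ 2, hs, ?_, ?_, ?_, ?_⟩
  · linear_combination (a11 ^ 21 + a11 ^ 14 + a11 ^ 7 + 1) * h7
  · have : a00 = ((a11 ^ 2) ^ 2) ^ 3 := by
      linear_combination a00 * (-a11 ^ 7 - 1) * h7 + a11 ^ 12 * h02
    simp [hA0, ← this, hb0]
  · have : a11 = ((a11 ^ 2) ^ 2) ^ 2 := by linear_combination -a11 * h7
    rw [← this]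
    simp [hA1, hb1]
  · simp [hA2, hb2]

/-- (Corollary 1 of the paper.)  The centralizer
`C = {α ∈ Aff_3(k) | α ∘ φ = φ ∘ α}` equals `{β_u | u ∈ k^*, u^7 = 1}`.
Consequently `C` is cyclic of order seven if `k` contains a primitive seventh
root of unity, and `C = {id}` otherwise. -/
theorem statement2 [CharZero k]
    (hln : ∀ h : MvPolynomial (Fin 3) k, ∃ l : ℕ, Del^[l] h = 0)
    (φ : MvPolynomial (Fin 3) k ≃ₐ[k] MvPolynomial (Fin 3) k)
    (hφ : IsExpOf Del φ) :
    ({α | IsAffine α ∧ α * φ = φ * α}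
        = {β : MvPolynomial (Fin 3) k ≃ₐ[k] MvPolynomial (Fin 3) k |
            ∃ u : k, u ≠ 0 ∧ u ^ 7 = 1 ∧ IsBeta u β}) ∧
    ((∃ ζ : k, IsPrimitiveRoot ζ 7) →
      ∃ c ∈ {α | IsAffine α ∧ α * φ = φ * α}, orderOf c = 7 ∧
        ∀ a ∈ {α | IsAffine α ∧ α * φ = φ * α}, ∃ n : ℕ, a = c ^ n) ∧
    (¬ (∃ ζ : k, IsPrimitiveRoot ζ 7) →
      {α | IsAffine α ∧ α * φ = φ * α} = ({1} :
        Set (MvPolynomial (Fin 3) k ≃ₐ[k] MvPolynomial (Fin 3) k))) := by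
  have hC : ({α | IsAffine α ∧ α * φ = φ * α} : Set _) =
      {β : MvPolynomial (Fin 3) k ≃ₐ[k] MvPolynomial (Fin 3) k |
        ∃ u : k, u ≠ 0 ∧ u ^ 7 = 1 ∧ IsBeta u β} := by
    ext α
    constructor
    · rintro ⟨haff, hα⟩
      exact exists_isBeta_of_Del_comm haff (Del_comm_of_exp_comm hln hφ hα)
    · rintro ⟨u, hu, hu7, hβ⟩
      exact ⟨hβ.isAffine hu, exp_comm_of_Del_comm hln hφ (hβ.Del_comm hu7)⟩
  have : Fact (Nat.Prime 7) := ⟨by norm_num⟩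
  refine ⟨hC, ?_, ?_⟩
  · rintro ⟨ζ, hζ⟩
    rw [hC]
    have hζ0 : ζ ≠ 0 := hζ.ne_zero (by norm_num)
    obtain ⟨c, hc⟩ := exists_isBeta hζ0
    refine ⟨c, ⟨ζ, hζ0, hζ.pow_eq_one, hc⟩,
      orderOf_eq_prime ?_ (hc.ne_one (hζ.ne_one (by norm_num))), ?_⟩
    · have := hc.pow 7
      rw [hζ.pow_eq_one] at this
      exact this.eq isBeta_one
    · rintro a ⟨u, -, hu7, ha⟩
      obtain ⟨n, -, rfl⟩ := hζ.eq_pow_of_pow_eq_one hu7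
      exact ⟨n, ha.eq (hc.pow n)⟩
  · intro hno
    rw [hC]
    ext a
    simp only [Set.mem_ofPred_eq, Set.mem_singleton_iff]
    constructor
    · rintro ⟨u, -, hu7, ha⟩
      have hu1 : u = 1 := by
        by_contra hu1
        exact hno ⟨u, orderOf_eq_prime hu7 hu1 ▸ IsPrimitiveRoot.orderOf u⟩
      subst hu1
      exact ha.eq isBeta_one
    · rintro rfl
      exact ⟨1, one_ne_zero, one_pow 7, isBeta_one⟩

end YasudaPaper
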